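/- arXiv:q-alg/9509013 — 5 statements merged into one kernel-verified Lean document; each statement's English description precedes it below -/
import Mathlib

section
/- Let 0 < q < 1 be real, let ν be a real number such that none of ν, ν−1, −ν, −ν+1 is a negative integer, and let z be real with 0 < z < 2/(1−q²). Then, with g(z) = z^ν I^{(1)}_ν((1−q²)z; q²) and h(z) = z^ν I^{(1)}_{−ν}((1−q²)z; q²): (2/((1+q)z)) ∂_q g(z) = z^{ν−1} I^{(1)}_{ν−1}((1−q²)z; q²) and (2/((1+q)z)) ∂_q h(z) = z^{ν−1} I^{(1)}_{−ν+1}((1−q²)z; q²). -/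
/-- The finite q-Pochhammer symbol `(a;q)_n = ∏_{j=0}^{n-1} (1 - a q^j)` (real version). -/
noncomputable def qPochR (a q : ℝ) (n : ℕ) : ℝ := ∏ j ∈ Finset.range n, (1 - a * q ^ j)

/-- The infinite q-Pochhammer symbol `(a;q)_∞ = ∏_{j=0}^{∞} (1 - a q^j)` (real version). -/
noncomputable def qPochInfR (a q : ℝ) : ℝ := ∏' j : ℕ, (1 - a * q ^ j)

/-- The q²-Gamma function `Γ_{q²}(s) = ((q²;q²)_∞ / (q^{2s};q²)_∞) (1-q²)^{1-s}`,
with `q^{2s} = exp(2s ln q)`. -/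
noncomputable def qGamma2 (q s : ℝ) : ℝ :=
  (qPochInfR (q ^ 2) (q ^ 2) / qPochInfR (Real.exp (2 * s * Real.log q)) (q ^ 2)) *
    (1 - q ^ 2) ^ (1 - s)

/-- The first modified q-Bessel function:
`I¹ q ν z = I^{(1)}_ν((1-q²)z; q²) = ∑_{k=0}^∞ (1-q²)^k (z/2)^{ν+2k} / ((q²;q²)_k Γ_{q²}(ν+k+1))`. -/
noncomputable def I1 (q ν z : ℝ) : ℝ :=
  ∑' k : ℕ, (1 - q ^ 2) ^ k * (z / 2) ^ (ν + 2 * (k : ℝ)) /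
    (qPochR (q ^ 2) (q ^ 2) k * qGamma2 q (ν + k + 1))

/-- The second modified q-Bessel function:
`I² q ν z = I^{(2)}_ν((1-q²)z; q²)
  = ∑_{k=0}^∞ q^{2k(ν+k)} (1-q²)^k (z/2)^{ν+2k} / ((q²;q²)_k Γ_{q²}(ν+k+1))`. -/
noncomputable def I2 (q ν z : ℝ) : ℝ :=
  ∑' k : ℕ, q ^ (2 * (k : ℝ) * (ν + k)) * (1 - q ^ 2) ^ k * (z / 2) ^ (ν + 2 * (k : ℝ)) /
    (qPochR (q ^ 2) (q ^ 2) k * qGamma2 q (ν + k + 1))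

/-- The q-derivative `∂_q f(z) = (f(z) - f(qz)) / ((1-q)z)`. -/
noncomputable def qDeriv (q : ℝ) (f : ℝ → ℝ) (z : ℝ) : ℝ := (f z - f (q * z)) / ((1 - q) * z)

theorem aux_gamma (q : ℝ) (hq0 : 0 < q) (hq1 : q < 1) (s : ℝ) :
    (1 - q ^ (2 * s)) * (qGamma2 q (s + 1))⁻¹ = (1 - q ^ 2) * (qGamma2 q s)⁻¹ := by
  have hq2 : 0 < 1 - q ^ 2 := by nlinarith
  have hE : Real.exp (2 * (s + 1) * Real.log q) = Real.exp (2 * s * Real.log q) * q ^ 2 := by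
    have : q ^ 2 = Real.exp (2 * Real.log q) := by
      rw [two_mul, Real.exp_add, Real.exp_log hq0]; ring
    rw [this, ← Real.exp_add]; congr 1; ring
  have hE2 : q ^ (2 * s) = Real.exp (2 * s * Real.log q) := by
    rw [Real.rpow_def_of_pos hq0]; congr 1; ring
  set a := Real.exp (2 * s * Real.log q) with ha
  have hP : qPochInfR a (q ^ 2) = (1 - a) * qPochInfR (a * q ^ 2) (q ^ 2) := by
    unfold qPochInfR
    have hm : Multipliable (fun j : ℕ => 1 - a * (q ^ 2) ^ (j + 1)) := by
      have hs : Summable (fun j : ℕ => ‖-(a * (q ^ 2) ^ (j + 1))‖) := by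
        have h0 : Summable (fun j : ℕ => (q ^ 2) ^ j) :=
          summable_geometric_of_lt_one (by positivity) (by linarith)
        have h1 := (h0.mul_left (a * q ^ 2)).norm
        refine h1.congr fun j => ?_
        rw [norm_neg]; congr 1; ring
      have := multipliable_one_add_of_summable hs
      simpa [sub_eq_add_neg] using this
    rw [tprod_eq_zero_mul' (f := fun j : ℕ => 1 - a * (q ^ 2) ^ j) hm]
    congr 1
    · simp
    · refine tprod_congr fun j => ?_
      ring
  have hr : (1 - q ^ 2) ^ (1 - s) = (1 - q ^ 2) * (1 - q ^ 2) ^ (1 - (s + 1)) := by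
    rw [show 1 - s = 1 + (1 - (s + 1)) by ring, Real.rpow_add hq2, Real.rpow_one]
  unfold qGamma2
  rw [← ha, hE, hE2, hP, hr]
  have : (1 - q ^ 2) ^ (1 - (s + 1)) ≠ 0 := (Real.rpow_pos_of_pos hq2 _).ne'
  simp only [mul_inv, inv_div]
  field_simp

/-- the general term -/
noncomputable def auxT (q ν z : ℝ) (k : ℕ) : ℝ :=
  (1 - q ^ 2) ^ k * (z / 2) ^ (ν + 2 * (k : ℝ)) /
    (qPochR (q ^ 2) (q ^ 2) k * qGamma2 q (ν + k + 1))

theorem aux_pow (q : ℝ) (hq0 : 0 < q) (hq1 : q < 1) (k : ℕ) : 0 < 1 - q ^ (2 * k + 2) := by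
  have : q ^ (2 * k + 2) < 1 := pow_lt_one₀ hq0.le hq1 (by omega)
  linarith

theorem aux_poch (q : ℝ) (k : ℕ) :
    qPochR (q ^ 2) (q ^ 2) (k + 1) = qPochR (q ^ 2) (q ^ 2) k * (1 - q ^ (2 * k + 2)) := by
  unfold qPochR
  rw [Finset.prod_range_succ]; congr 2; ring

theorem aux_ratio (q : ℝ) (hq0 : 0 < q) (hq1 : q < 1) (ν z : ℝ) (hz0 : 0 < z) (k : ℕ) :
    auxT q ν z (k + 1) * ((1 - q ^ (2 * k + 2)) * (1 - q ^ (2 * (ν + k + 1)))) =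
      auxT q ν z k * ((1 - q ^ 2) * (z / 2)) ^ 2 := by
  have hk := (aux_pow q hq0 hq1 k).ne'
  have hg := aux_gamma q hq0 hq1 (ν + k + 1)
  have hz2 : (z / 2) ^ (ν + 2 * ((k + 1 : ℕ) : ℝ)) = (z / 2) ^ (ν + 2 * (k : ℝ)) * (z / 2) ^ 2 := by
    rw [← Real.rpow_natCast (z / 2) 2, ← Real.rpow_add (by positivity)]
    congr 1; push_cast; ring
  unfold auxT
  rw [aux_poch, hz2, show ν + ((k + 1 : ℕ) : ℝ) + 1 = ν + k + 1 + 1 by push_cast; ring]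
  simp only [div_eq_mul_inv, mul_inv] at hg ⊢
  calc _ = (1 - q ^ 2) ^ (k + 1) * ((z * 2⁻¹) ^ (ν + 2 * (k : ℝ)) * (z * 2⁻¹) ^ 2) *
        (qPochR (q ^ 2) (q ^ 2) k)⁻¹ * ((1 - q ^ (2 * k + 2))⁻¹ * (1 - q ^ (2 * k + 2))) *
        ((1 - q ^ (2 * (ν + k + 1))) * (qGamma2 q (ν + k + 1 + 1))⁻¹) := by ring
    _ = _ := by rw [hg, inv_mul_cancel₀ hk]; ring

theorem aux_summable (q : ℝ) (hq0 : 0 < q) (hq1 : q < 1) (ν z : ℝ) (hz0 : 0 < z)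
    (hz : z < 2 / (1 - q ^ 2)) : Summable (auxT q ν z) := by
  have hq2 : 0 < 1 - q ^ 2 := by nlinarith
  set r := ((1 - q ^ 2) * (z / 2)) ^ 2 with hr
  have hr0 : 0 < r := by positivity
  have hr1 : r < 1 := by
    rw [lt_div_iff₀ hq2] at hz
    apply pow_lt_one₀ (by positivity) (by linarith) (by norm_num)
  have hp : Filter.Tendsto (fun k : ℕ => q ^ (2 * k + 2)) Filter.atTop (nhds 0) := by
    have h := (tendsto_pow_atTop_nhds_zero_of_lt_one (r := q ^ 2) (by positivity)
      (by linarith)).mul_const (q ^ 2)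
    rw [zero_mul] at h
    refine h.congr fun k => ?_
    ring
  have hp2 : Filter.Tendsto (fun k : ℕ => q ^ (2 * (ν + k + 1))) Filter.atTop (nhds 0) := by
    have h := hp.mul_const (q ^ (2 * ν))
    rw [zero_mul] at h
    refine h.congr fun k => ?_
    rw [← Real.rpow_natCast, ← Real.rpow_add hq0]
    congr 1; push_cast; ring
  have hd : Filter.Tendsto (fun k : ℕ => (1 - q ^ (2 * k + 2)) * (1 - q ^ (2 * (ν + k + 1))))
      Filter.atTop (nhds 1) := by
    simpa using (hp.const_sub 1).mul (hp2.const_sub 1)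
  obtain ⟨ρ, hρ1, hρ2⟩ := exists_between hr1
  have hρ0 : 0 < ρ := hr0.trans hρ1
  have hlt : r / ρ < 1 := by rw [div_lt_one hρ0]; exact hρ1
  refine summable_of_ratio_norm_eventually_le hρ2 ?_
  filter_upwards [hd.eventually (lt_mem_nhds hlt)] with k hk
  have h := aux_ratio q hq0 hq1 ν z hz0 k
  rw [← hr] at h
  set d := (1 - q ^ (2 * k + 2)) * (1 - q ^ (2 * (ν + k + 1)))
  have hd0 : 0 < r / ρ := by positivity
  have h' : ‖auxT q ν z (k + 1)‖ * d = ‖auxT q ν z k‖ * r := by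
    have := congrArg norm h
    rwa [norm_mul _ d, norm_mul _ r, Real.norm_of_nonneg hr0.le,
      Real.norm_of_nonneg (hd0.trans hk).le] at this
  have h3 : ‖auxT q ν z (k + 1)‖ * (r / ρ) ≤ ‖auxT q ν z k‖ * r := by
    rw [← h']; gcongr
  have h4 : ‖auxT q ν z (k + 1)‖ * (r / ρ) = (‖auxT q ν z (k + 1)‖ / ρ) * r := by ring
  rw [h4] at h3
  have h5 := le_of_mul_le_mul_right h3 hr0
  rw [div_le_iff₀ hρ0] at h5
  linarith

theorem aux_q (q : ℝ) (hq0 : 0 < q) (hq1 : q < 1) (ν μ : ℝ)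
    (z : ℝ) (hz0 : 0 < z) (hz : z < 2 / (1 - q ^ 2)) :
    (2 / ((1 + q) * z)) * qDeriv q (fun t => t ^ ν * I1 q μ t) z
      = ∑' k : ℕ, 2 / ((1 - q ^ 2) * z ^ 2) * (z ^ ν *
        ((1 - q ^ (ν + μ + 2 * (k : ℝ))) * auxT q μ z k)) := by
  have hq2 : 0 < 1 - q ^ 2 := by nlinarith
  have hI : ∀ t, I1 q μ t = ∑' k, auxT q μ t k := fun t => rfl
  have hs1 := aux_summable q hq0 hq1 μ z hz0 hz
  have hs2 := aux_summable q hq0 hq1 μ (q * z) (by positivity) (by nlinarith)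
  unfold qDeriv
  simp only [hI]
  rw [← tsum_mul_left (a := z ^ ν), ← tsum_mul_left (a := (q * z) ^ ν),
    ← (hs1.mul_left _).tsum_sub (hs2.mul_left _), ← tsum_div_const, ← tsum_mul_left]
  refine tsum_congr fun k => ?_
  have e : (q * z) ^ ν * auxT q μ (q * z) k
      = z ^ ν * (q ^ (ν + μ + 2 * (k : ℝ)) * auxT q μ z k) := by
    unfold auxT
    rw [mul_div_assoc q z 2, Real.mul_rpow hq0.le hz0.le, Real.mul_rpow hq0.le (by positivity),
      add_assoc ν μ, Real.rpow_add hq0 ν]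
    ring
  rw [e]
  have : 1 - q ≠ 0 := by linarith
  have : 1 + q ≠ 0 := by linarith
  rw [show 1 - q ^ 2 = (1 - q) * (1 + q) by ring]
  field_simp

/-- The q-derivative relations (3.7)/(3.8) for `I^{(1)}`:
`(2/((1+q)z)) ∂_q [z^ν I^{(1)}_ν((1-q²)z;q²)] = z^{ν-1} I^{(1)}_{ν-1}((1-q²)z;q²)` and
`(2/((1+q)z)) ∂_q [z^ν I^{(1)}_{-ν}((1-q²)z;q²)] = z^{ν-1} I^{(1)}_{-ν+1}((1-q²)z;q²)`. -/
theorem stmt5 (q : ℝ) (hq0 : 0 < q) (hq1 : q < 1) (ν : ℝ)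
    (h1 : ∀ m : ℤ, m < 0 → ν ≠ m) (h2 : ∀ m : ℤ, m < 0 → ν - 1 ≠ m)
    (h3 : ∀ m : ℤ, m < 0 → -ν ≠ m) (h4 : ∀ m : ℤ, m < 0 → -ν + 1 ≠ m)
    (z : ℝ) (hz0 : 0 < z) (hz : z < 2 / (1 - q ^ 2)) :
    (2 / ((1 + q) * z)) * qDeriv q (fun t => t ^ ν * I1 q ν t) z
        = z ^ (ν - 1) * I1 q (ν - 1) z ∧
    (2 / ((1 + q) * z)) * qDeriv q (fun t => t ^ ν * I1 q (-ν) t) z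
        = z ^ (ν - 1) * I1 q (-ν + 1) z := by
  have hq2 : 0 < 1 - q ^ 2 := by nlinarith
  have hI : ∀ μ, I1 q μ z = ∑' k, auxT q μ z k := fun t => rfl
  have hzν : z ^ ν = z ^ (ν - 1) * z := by
    rw [← Real.rpow_add_one hz0.ne']; congr 1; ring
  constructor
  · rw [aux_q q hq0 hq1 ν ν z hz0 hz, hI, ← tsum_mul_left]
    refine tsum_congr fun k => ?_
    have hg := aux_gamma q hq0 hq1 (ν + k)
    have e : (z / 2) ^ (ν + 2 * (k : ℝ)) = (z / 2) ^ (ν - 1 + 2 * (k : ℝ)) * (z / 2) := by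
      rw [← Real.rpow_add_one (by positivity)]; congr 1; ring
    have hk : (1 - q ^ (ν + ν + 2 * (k : ℝ))) * auxT q ν z k
        = auxT q (ν - 1) z k * (1 - q ^ 2) * (z / 2) := by
      unfold auxT
      rw [e, show ν + ν + 2 * (k : ℝ) = 2 * (ν + k) by ring, show ν - 1 + (k : ℝ) + 1 = ν + k by ring]
      simp only [div_eq_mul_inv, mul_inv] at hg ⊢
      linear_combination ((1 - q ^ 2) ^ k * ((z * 2⁻¹) ^ (ν - 1 + 2 * (k : ℝ)) * (z * 2⁻¹)) *
        (qPochR (q ^ 2) (q ^ 2) k)⁻¹) * hg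
    rw [hk, hzν]
    field_simp
  · have hs : Summable (fun k : ℕ => 2 / ((1 - q ^ 2) * z ^ 2) * (z ^ ν *
        ((1 - q ^ (ν + -ν + 2 * (k : ℝ))) * auxT q (-ν) z k))) := by
      have hs1 := aux_summable q hq0 hq1 (-ν) z hz0 hz
      refine Summable.mul_left _ (Summable.mul_left _ ?_)
      refine Summable.of_norm_bounded hs1.norm fun k => ?_
      rw [norm_mul]
      refine mul_le_of_le_one_left (norm_nonneg _) ?_
      have a1 : 0 < q ^ (ν + -ν + 2 * (k : ℝ)) := Real.rpow_pos_of_pos hq0 _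
      have a2 : q ^ (ν + -ν + 2 * (k : ℝ)) ≤ 1 :=
        Real.rpow_le_one hq0.le hq1.le (by rw [add_neg_cancel]; positivity)
      rw [Real.norm_of_nonneg (by linarith)]; linarith
    rw [aux_q q hq0 hq1 ν (-ν) z hz0 hz, hI, ← tsum_mul_left, hs.tsum_eq_zero_add]
    have h0 : (1 - q ^ (ν + -ν + 2 * ((0 : ℕ) : ℝ))) = 0 := by simp
    rw [h0, zero_mul, mul_zero, mul_zero, zero_add]
    refine tsum_congr fun k => ?_
    have hp := (aux_pow q hq0 hq1 k).ne'
    have e : (z / 2) ^ (-ν + 2 * ((k + 1 : ℕ) : ℝ)) = (z / 2) ^ (-ν + 1 + 2 * (k : ℝ)) * (z / 2) := by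
      rw [← Real.rpow_add_one (by positivity)]; congr 1; push_cast; ring
    have e2 : q ^ (ν + -ν + 2 * ((k + 1 : ℕ) : ℝ)) = q ^ (2 * k + 2) := by
      rw [← Real.rpow_natCast]; congr 1; push_cast; ring
    have hk : (1 - q ^ (2 * k + 2)) * auxT q (-ν) z (k + 1)
        = auxT q (-ν + 1) z k * (1 - q ^ 2) * (z / 2) := by
      unfold auxT
      rw [e, aux_poch, show -ν + ((k + 1 : ℕ) : ℝ) + 1 = -ν + 1 + k + 1 by push_cast; ring]
      simp only [div_eq_mul_inv, mul_inv]
      linear_combination ((1 - q ^ 2) ^ (k + 1) * ((z * 2⁻¹) ^ (-ν + 1 + 2 * (k : ℝ)) * (z * 2⁻¹)) *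
        (qPochR (q ^ 2) (q ^ 2) k)⁻¹ * (qGamma2 q (-ν + 1 + k + 1))⁻¹) * mul_inv_cancel₀ hp
    rw [e2, hk, hzν]
    field_simp
end

section
/- Let 0 < q < 1 be real, let ν be a real number such that none of ν, ν−1, ν+1 is a negative integer, and let z be real with 0 < z < 2/(1−q²). Then: (i) I^{(1)}_{ν−1}((1−q²)z;q²) − I^{(1)}_{ν+1}((1−q²)z;q²) = (2/((1−q²)z))(q^{−ν} − q^{ν}) I^{(1)}_ν((1−q²)qz;q²); (ii) I^{(1)}_{ν−1}((1−q²)z;q²) + I^{(1)}_{ν+1}((1−q²)z;q²) = (4/((1−q²)z)) I^{(1)}_ν((1−q²)z;q²) − (2/((1−q²)z))(q^{−ν} + q^{ν}) I^{(1)}_ν((1−q²)qz;q²). -/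
open Filter Topology in
lemma qP_step (q : ℝ) (hq0 : 0 < q) (hq1 : q < 1) (s : ℝ) :
    qPochInfR (Real.exp (2 * s * Real.log q)) (q ^ 2) =
      (1 - Real.exp (2 * s * Real.log q)) *
        qPochInfR (Real.exp (2 * (s + 1) * Real.log q)) (q ^ 2) := by
  have hp1 : q ^ 2 < 1 := by nlinarith
  have hE : Real.exp (2 * (s + 1) * Real.log q) = Real.exp (2 * s * Real.log q) * q ^ 2 := by
    have : 2 * (s + 1) * Real.log q = 2 * s * Real.log q + Real.log q + Real.log q := by ring
    rw [this, Real.exp_add, Real.exp_add, Real.exp_log hq0]; ring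
  have hsum : Summable (fun j : ℕ => -(Real.exp (2 * (s + 1) * Real.log q) * (q ^ 2) ^ j)) :=
    ((summable_geometric_of_lt_one (by positivity) hp1).mul_left _).neg
  have hm := Real.multipliable_one_add_of_summable hsum
  have hf : ∀ j : ℕ, 1 - Real.exp (2 * s * Real.log q) * (q ^ 2) ^ (j + 1) =
      1 + -(Real.exp (2 * (s + 1) * Real.log q) * (q ^ 2) ^ j) := by
    intro j; rw [hE]; ring
  unfold qPochInfR
  rw [tprod_eq_zero_mul' (f := fun j : ℕ => 1 - Real.exp (2 * s * Real.log q) * (q ^ 2) ^ j)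
    (by simpa only [hf] using hm)]
  simp only [hf, pow_zero, mul_one]
  simp only [sub_eq_add_neg]

lemma I1_term (q : ℝ) (hq0 : 0 < q) (hq1 : q < 1) (ν z : ℝ) (hz0 : 0 < z) (k : ℕ) :
    (1 - q ^ 2) ^ k * (z / 2) ^ (ν + 2 * (k : ℝ)) /
      (qPochR (q ^ 2) (q ^ 2) k * qGamma2 q (ν + k + 1)) =
    ((1 - q ^ 2) * (z / 2)) ^ ν * (((1 - q ^ 2) * (z / 2)) ^ 2) ^ k *
      qPochInfR (Real.exp (2 * (ν + k + 1) * Real.log q)) (q ^ 2) *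
      (qPochR (q ^ 2) (q ^ 2) k * qPochInfR (q ^ 2) (q ^ 2))⁻¹ := by
  have hp : 0 < 1 - q ^ 2 := by nlinarith
  have hz2 : 0 < z / 2 := by positivity
  unfold qGamma2
  generalize 1 - q ^ 2 = w at *
  have e1 : 1 - (ν + k + 1) = -(ν + (k : ℝ)) := by ring
  have e2 : (z / 2) ^ (ν + 2 * (k : ℝ)) = (z / 2) ^ ν * ((z / 2) ^ 2) ^ k := by
    rw [Real.rpow_add hz2, ← pow_mul, ← Real.rpow_natCast]; push_cast; rfl
  rw [e1, e2, Real.rpow_neg hp.le, Real.rpow_add hp, Real.rpow_natCast,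
    Real.mul_rpow hp.le hz2.le]
  simp only [div_eq_mul_inv, mul_inv, inv_inv, mul_pow]
  ring

lemma qPochR_ne (q : ℝ) (hq0 : 0 < q) (hq1 : q < 1) (k : ℕ) :
    qPochR (q ^ 2) (q ^ 2) k ≠ 0 := by
  unfold qPochR
  refine Finset.prod_ne_zero_iff.2 fun j _ => ?_
  have hp1 : q ^ 2 < 1 := by nlinarith
  have : (q ^ 2) ^ (j + 1) < 1 := pow_lt_one₀ (by positivity) hp1 (by omega)
  rw [pow_succ'] at this
  linarith

/-- The recurrence relations (3.9)/(3.10) for `I^{(1)}`: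
`I^{(1)}_{ν-1}((1-q²)z;q²) - I^{(1)}_{ν+1}((1-q²)z;q²)
   = (2/((1-q²)z))(q^{-ν}-q^ν) I^{(1)}_ν((1-q²)qz;q²)` and
`I^{(1)}_{ν-1}((1-q²)z;q²) + I^{(1)}_{ν+1}((1-q²)z;q²)
   = (4/((1-q²)z)) I^{(1)}_ν((1-q²)z;q²) - (2/((1-q²)z))(q^{-ν}+q^ν) I^{(1)}_ν((1-q²)qz;q²)`. -/
theorem stmt6 (q : ℝ) (hq0 : 0 < q) (hq1 : q < 1) (ν : ℝ)
    (h1 : ∀ m : ℤ, m < 0 → ν ≠ m) (h2 : ∀ m : ℤ, m < 0 → ν - 1 ≠ m)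
    (h3 : ∀ m : ℤ, m < 0 → ν + 1 ≠ m)
    (z : ℝ) (hz0 : 0 < z) (hz : z < 2 / (1 - q ^ 2)) :
    I1 q (ν - 1) z - I1 q (ν + 1) z
        = (2 / ((1 - q ^ 2) * z)) * (q ^ (-ν) - q ^ ν) * I1 q ν (q * z) ∧
    I1 q (ν - 1) z + I1 q (ν + 1) z
        = (4 / ((1 - q ^ 2) * z)) * I1 q ν z
          - (2 / ((1 - q ^ 2) * z)) * (q ^ (-ν) + q ^ ν) * I1 q ν (q * z) := by
  have hp1 : q ^ 2 < 1 := by nlinarith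
  have hp : 0 < 1 - q ^ 2 := by linarith
  have hqz : 0 < q * z := by positivity
  set x : ℝ := (1 - q ^ 2) * (z / 2) with hx
  have hx0 : 0 < x := by positivity
  have hx1 : x < 1 := by
    rw [lt_div_iff₀ hp] at hz; rw [hx]; linarith
  set P : ℝ → ℝ := fun s => qPochInfR (Real.exp (2 * s * Real.log q)) (q ^ 2) with hP
  set D : ℕ → ℝ := fun k => (qPochR (q ^ 2) (q ^ 2) k * qPochInfR (q ^ 2) (q ^ 2))⁻¹ with hD
  set E : ℝ := q ^ ν with hE
  have hE0 : 0 < E := by positivity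
  have hexp : ∀ k : ℕ, Real.exp (2 * (ν + k) * Real.log q) = E ^ 2 * (q ^ 2) ^ k := by
    intro k
    rw [hE, Real.rpow_def_of_pos hq0, ← pow_mul, ← Real.exp_log (pow_pos hq0 (2 * k)),
      Real.log_pow, ← Real.exp_nat_mul, ← Real.exp_add]
    congr 1; push_cast; ring
  have hPs : ∀ k : ℕ, P (ν + k) = (1 - E ^ 2 * (q ^ 2) ^ k) * P (ν + k + 1) := by
    intro k
    simp only [hP]
    rw [qP_step q hq0 hq1, hexp]
  have hDs : ∀ k : ℕ, D k = (1 - (q ^ 2) ^ (k + 1)) * D (k + 1) := by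
    intro k
    have hne := qPochR_ne q hq0 hq1 (k + 1)
    have h : qPochR (q ^ 2) (q ^ 2) (k + 1) =
        qPochR (q ^ 2) (q ^ 2) k * (1 - (q ^ 2) ^ (k + 1)) := by
      unfold qPochR; rw [Finset.prod_range_succ, pow_succ' (q ^ 2) k]
    rw [h] at hne
    have hne2 := right_ne_zero_of_mul hne
    simp only [hD]
    rw [h]
    simp only [mul_inv]
    field_simp
  set c : ℕ → ℝ := fun k => x ^ (ν - 1) * (x ^ 2) ^ k * P (ν + k + 1) * D k with hc
  have hrec : ∀ k : ℕ, c (k + 1) * ((1 - E ^ 2 * (q ^ 2) ^ (k + 1)) * (1 - (q ^ 2) ^ (k + 1)))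
      = x ^ 2 * c k := by
    intro k
    have := hPs (k + 1)
    simp only [hc]
    rw [hDs k]
    push_cast at this ⊢
    rw [show ν + (k : ℝ) + 1 = ν + (k + 1) by ring, this]
    ring
  have hS : Summable c := by
    obtain ⟨r, hr1, hr2⟩ := exists_between (show x ^ 2 < 1 by nlinarith)
    have hr0 : 0 < r := lt_trans (by positivity) hr1
    refine summable_of_ratio_norm_eventually_le (r := r) hr2 ?_
    have ht0 : Filter.Tendsto (fun k : ℕ => (q ^ 2) ^ (k + 1)) Filter.atTop (nhds 0) :=
      (tendsto_pow_atTop_nhds_zero_of_lt_one (by positivity) hp1).comp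
        (Filter.tendsto_add_atTop_nat 1)
    have ht : Filter.Tendsto (fun k : ℕ => (1 - E ^ 2 * (q ^ 2) ^ (k + 1)) *
        (1 - (q ^ 2) ^ (k + 1))) Filter.atTop (nhds ((1 - E ^ 2 * 0) * (1 - 0))) :=
      ((ht0.const_mul (E ^ 2)).const_sub 1).mul (ht0.const_sub 1)
    have hlt : x ^ 2 / r < (1 - E ^ 2 * 0) * (1 - 0) := by
      rw [div_lt_iff₀ hr0]; linarith
    filter_upwards [ht.eventually_const_lt hlt] with k hk
    have hk0 : 0 < x ^ 2 / r := by positivity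
    have h := congrArg norm (hrec k)
    rw [norm_mul, norm_mul (x ^ 2), Real.norm_of_nonneg (hk0.trans hk).le,
      Real.norm_of_nonneg (by positivity : (0:ℝ) ≤ x ^ 2)] at h
    have h4 : ‖c (k + 1)‖ * (x ^ 2 / r) ≤ x ^ 2 * ‖c k‖ := by
      rw [← h]; exact mul_le_mul_of_nonneg_left hk.le (norm_nonneg _)
    have h5 : x ^ 2 * ‖c k‖ = (r * ‖c k‖) * (x ^ 2 / r) := by field_simp
    rw [h5] at h4
    exact le_of_mul_le_mul_right h4 hk0
  have hS1 : Summable (fun k => (q ^ 2) ^ k * c k) := by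
    refine Summable.of_norm_bounded hS.norm fun k => ?_
    rw [norm_mul, Real.norm_of_nonneg (by positivity)]
    exact mul_le_of_le_one_left (norm_nonneg _) (pow_le_one₀ (by positivity) hp1.le)
  have hxm : x ^ ν = x * x ^ (ν - 1) := by
    rw [Real.rpow_sub_one hx0.ne']; field_simp
  have hxp : x ^ (ν + 1) = x ^ 2 * x ^ (ν - 1) := by
    rw [Real.rpow_add_one hx0.ne', hxm]; ring
  have A0 : I1 q ν z = x * ∑' k, c k := by
    unfold I1
    rw [← tsum_mul_left]
    refine tsum_congr fun k => ?_
    rw [I1_term q hq0 hq1 ν z hz0, ← hx, hxm]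
    simp only [hc, hP, hD]; ring
  have A1 : I1 q ν (q * z) = x * E * ∑' k, (q ^ 2) ^ k * c k := by
    unfold I1
    rw [← tsum_mul_left]
    refine tsum_congr fun k => ?_
    rw [I1_term q hq0 hq1 ν (q * z) hqz,
      show (1 - q ^ 2) * (q * z / 2) = q * x by rw [hx]; ring, Real.mul_rpow hq0.le hx0.le, hxm,
      mul_pow, mul_pow]
    simp only [hc, hP, hD, hE]; ring
  have A2 : I1 q (ν - 1) z = ∑' k, c k - E ^ 2 * ∑' k, (q ^ 2) ^ k * c k := by
    unfold I1
    rw [← tsum_mul_left, ← hS.tsum_sub (hS1.mul_left _)]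
    refine tsum_congr fun k => ?_
    have := hPs k
    rw [I1_term q hq0 hq1 (ν - 1) z hz0, ← hx, show ν - 1 + (k : ℝ) + 1 = ν + k by ring]
    change _ * P (ν + k) * D k = _
    rw [this]
    simp only [hc]; ring
  have A3 : I1 q (ν + 1) z = ∑' k, c k - ∑' k, (q ^ 2) ^ k * c k := by
    rw [← hS.tsum_sub hS1, (hS.sub hS1).tsum_eq_zero_add]
    simp only [pow_zero, one_mul, sub_self, zero_add]
    unfold I1
    refine tsum_congr fun k => ?_
    rw [I1_term q hq0 hq1 (ν + 1) z hz0, ← hx, hxp]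
    change _ * P (ν + 1 + k + 1) * D k = _
    rw [hDs k]
    simp only [hc]
    push_cast
    rw [show ν + 1 + (k : ℝ) + 1 = ν + (k + 1) + 1 by ring]
    ring
  have hzx : (1 - q ^ 2) * z = 2 * x := by rw [hx]; ring
  rw [A0, A1, A2, A3, hzx, Real.rpow_neg hq0.le, ← hE]
  constructor
  · field_simp
    ring
  · field_simp
    ring
end

section
/- Let 0 < q < 1 be real, let ν be a real number such that none of ν, ν−1, ν+1 is a negative integer, and let z > 0 be real. Then: (i) q^{−ν} I^{(2)}_{ν−1}((1−q²)z;q²) − q^{ν} I^{(2)}_{ν+1}((1−q²)z;q²) = (2/((1−q²)z))(q^{−ν} − q^{ν}) I^{(2)}_ν((1−q²)z;q²); (ii) q^{−ν} I^{(2)}_{ν−1}((1−q²)z;q²) + q^{ν} I^{(2)}_{ν+1}((1−q²)z;q²) = (4/((1−q²)z)) I^{(2)}_ν((1−q²)q^{−1}z;q²) − (2/((1−q²)z))(q^{−ν} + q^{ν}) I^{(2)}_ν((1−q²)z;q²). -/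
noncomputable def tI (q ν z : ℝ) (k : ℕ) : ℝ :=
  q ^ (2 * (k : ℝ) * (ν + k)) * (1 - q ^ 2) ^ k * (z / 2) ^ (ν + 2 * (k : ℝ)) /
    (qPochR (q ^ 2) (q ^ 2) k * qGamma2 q (ν + k + 1))

lemma qPochInf_rec (a p : ℝ) (hp0 : 0 < p) (hp1 : p < 1) :
    qPochInfR a p = (1 - a) * qPochInfR (a * p) p := by
  unfold qPochInfR
  have hm : Multipliable (fun j : ℕ => 1 - a * p ^ (j + 1)) := by
    have : Summable (fun j : ℕ => ‖-(a * p ^ (j + 1))‖) := by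
      have h := ((summable_geometric_of_lt_one hp0.le hp1).mul_left (|a| * p))
      refine h.congr fun j => ?_
      rw [norm_neg, norm_mul, Real.norm_eq_abs, Real.norm_eq_abs, abs_of_pos (pow_pos hp0 _)]
      ring
    simpa [sub_eq_add_neg] using multipliable_one_add_of_summable this
  have h := tprod_eq_zero_mul' (f := fun j : ℕ => 1 - a * p ^ j) hm
  have h2 : ∀ j : ℕ, 1 - a * p ^ (j + 1) = 1 - a * p * p ^ j := fun j => by ring
  simp only [h2, pow_zero, mul_one] at h
  exact h

lemma gam_rec (q : ℝ) (hq0 : 0 < q) (hq1 : q < 1) (s : ℝ) :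
    (qGamma2 q s)⁻¹ = (qGamma2 q (s + 1))⁻¹ * ((1 - q ^ (2 * s)) / (1 - q ^ 2)) := by
  have hp : q ^ 2 < 1 := by nlinarith
  have hp' : 0 < 1 - q ^ 2 := by linarith
  have e1 : Real.exp (2 * s * Real.log q) = q ^ (2 * s) := by
    rw [Real.rpow_def_of_pos hq0]; ring_nf
  have e2 : Real.exp (2 * (s + 1) * Real.log q) = q ^ (2 * s) * q ^ 2 := by
    rw [← Real.rpow_natCast q 2, ← Real.rpow_add hq0, Real.rpow_def_of_pos hq0]
    push_cast; ring_nf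
  unfold qGamma2
  rw [e1, e2, qPochInf_rec (q ^ (2 * s)) (q ^ 2) (by positivity) hp]
  have e3 : (1 - q ^ 2) ^ (1 - s) = (1 - q ^ 2) ^ (1 - (s + 1)) * (1 - q ^ 2) := by
    rw [← Real.rpow_add_one hp'.ne']; ring_nf
  rw [e3]
  simp only [mul_inv, inv_div, div_eq_mul_inv, inv_inv]
  ring

lemma tI_down (q : ℝ) (hq0 : 0 < q) (hq1 : q < 1) (ν z : ℝ) (hz : 0 < z) (k : ℕ) :
    q ^ (-ν) * tI q (ν - 1) z k =
      2 / ((1 - q ^ 2) * z) * (tI q ν (q⁻¹ * z) k - q ^ ν * tI q ν z k) := by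
  have hp' : 0 < 1 - q ^ 2 := by nlinarith
  unfold tI
  have a1 : q ^ (2 * (k : ℝ) * (ν - 1 + k)) = q ^ (2 * (k : ℝ) * (ν + k)) * (q ^ (2 * (k:ℝ)))⁻¹ := by
    rw [← Real.rpow_neg hq0.le, ← Real.rpow_add hq0]; ring_nf
  have a2 : (z / 2) ^ (ν - 1 + 2 * (k : ℝ)) = (z / 2) ^ (ν + 2 * (k : ℝ)) * (2 / z) := by
    rw [show ν - 1 + 2 * (k : ℝ) = ν + 2 * k - 1 by ring, Real.rpow_sub_one (by positivity)]
    field_simp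
  have a3 : (q⁻¹ * z / 2) ^ (ν + 2 * (k : ℝ)) =
      (z / 2) ^ (ν + 2 * (k : ℝ)) * ((q ^ ν)⁻¹ * (q ^ (2 * (k:ℝ)))⁻¹) := by
    rw [show q⁻¹ * z / 2 = (z / 2) * q⁻¹ by ring, Real.mul_rpow (by positivity) (by positivity),
      Real.inv_rpow hq0.le, Real.rpow_add hq0, mul_inv]
  have a4 : (qGamma2 q (ν - 1 + k + 1))⁻¹ = (qGamma2 q (ν + k + 1))⁻¹ *
      ((1 - q ^ ν * q ^ ν * q ^ (2 * (k:ℝ))) / (1 - q ^ 2)) := by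
    rw [show ν - 1 + (k:ℝ) + 1 = ν + k by ring, gam_rec q hq0 hq1, ← Real.rpow_add hq0,
      ← Real.rpow_add hq0]
    ring_nf
  simp only [div_eq_mul_inv _ (qPochR _ _ _ * _), mul_inv (qPochR _ _ _)]
  rw [a1, a2, a3, a4, Real.rpow_neg hq0.le]
  have n1 : q ^ ν ≠ 0 := (Real.rpow_pos_of_pos hq0 _).ne'
  have n2 : q ^ (2 * (k:ℝ)) ≠ 0 := (Real.rpow_pos_of_pos hq0 _).ne'
  generalize (qGamma2 q (ν + k + 1))⁻¹ = G
  generalize (qPochR (q ^ 2) (q ^ 2) k)⁻¹ = P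
  generalize q ^ ν = A at *
  generalize q ^ (2 * (k:ℝ)) = B at *
  field_simp

lemma poch_succ (q : ℝ) (hq0 : 0 < q) (hq1 : q < 1) (k : ℕ) :
    (qPochR (q ^ 2) (q ^ 2) k)⁻¹ =
      (qPochR (q ^ 2) (q ^ 2) (k+1))⁻¹ * (1 - q ^ 2 * q ^ (2 * (k:ℝ))) ∧
      1 - q ^ 2 ≤ 1 - q ^ 2 * q ^ (2 * (k:ℝ)) := by
  have e : q ^ (2 * (k:ℝ)) = (q ^ 2) ^ k := by
    rw [← pow_mul, ← Real.rpow_natCast]; push_cast; rfl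
  have hp : q ^ 2 < 1 := by nlinarith
  have hl : (q ^ 2) ^ k ≤ 1 := pow_le_one₀ (by positivity) hp.le
  have hb : 1 - q ^ 2 ≤ 1 - q ^ 2 * q ^ (2 * (k:ℝ)) := by
    rw [e]; nlinarith [sq_nonneg q]
  refine ⟨?_, hb⟩
  have : 1 - q ^ 2 * q ^ (2 * (k:ℝ)) ≠ 0 := by linarith
  unfold qPochR
  rw [Finset.prod_range_succ, ← e, mul_inv, mul_assoc, inv_mul_cancel₀ this, mul_one]

lemma tI_up (q : ℝ) (hq0 : 0 < q) (hq1 : q < 1) (ν z : ℝ) (hz : 0 < z) (k : ℕ) :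
    q ^ ν * tI q (ν + 1) z k =
      2 / ((1 - q ^ 2) * z) * (tI q ν (q⁻¹ * z) (k+1) - q ^ (-ν) * tI q ν z (k+1)) := by
  have hp' : 0 < 1 - q ^ 2 := by nlinarith
  unfold tI
  push_cast
  have a1 : q ^ (2 * ((k : ℝ)+1) * (ν + (k+1))) =
      q ^ (2 * (k : ℝ) * (ν + 1 + k)) * (q ^ ν * q ^ ν * q ^ (2 * (k:ℝ)) * q ^ 2) := by
    rw [← Real.rpow_natCast q 2]; simp only [← Real.rpow_add hq0]; push_cast; ring_nf
  have a2 : (z / 2) ^ (ν + 2 * ((k : ℝ) + 1)) = (z / 2) ^ (ν + 1 + 2 * (k : ℝ)) * (z / 2) := by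
    rw [← Real.rpow_add_one (by positivity)]; ring_nf
  have a3 : (q⁻¹ * z / 2) ^ (ν + 2 * ((k : ℝ)+1)) =
      (z / 2) ^ (ν + 2 * ((k : ℝ)+1)) * ((q ^ ν)⁻¹ * (q ^ (2 * (k:ℝ)))⁻¹ * (q^2)⁻¹) := by
    rw [show q⁻¹ * z / 2 = (z / 2) * q⁻¹ by ring, Real.mul_rpow (by positivity) (by positivity),
      Real.inv_rpow hq0.le, ← mul_inv, ← mul_inv, ← Real.rpow_natCast q 2]
    simp only [← Real.rpow_add hq0]; push_cast; ring_nf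
  simp only [div_eq_mul_inv _ (qPochR _ _ _ * _), mul_inv (qPochR _ _ _)]
  rw [a3, a1, a2, (poch_succ q hq0 hq1 k).1, Real.rpow_neg hq0.le,
    show ν + 1 + (k:ℝ) + 1 = ν + (k + 1) + 1 by ring]
  have n1 : q ^ ν ≠ 0 := (Real.rpow_pos_of_pos hq0 _).ne'
  have n2 : q ^ (2 * (k:ℝ)) ≠ 0 := (Real.rpow_pos_of_pos hq0 _).ne'
  generalize (qGamma2 q (ν + (k + 1) + 1))⁻¹ = G
  generalize (qPochR (q ^ 2) (q ^ 2) (k+1))⁻¹ = P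
  generalize q ^ ν = A at *
  generalize q ^ (2 * (k:ℝ)) = B at *
  rw [pow_succ (1 - q ^ 2) k]
  field_simp
  try ring

lemma tI_zero (q : ℝ) (hq0 : 0 < q) (ν z : ℝ) (hz : 0 < z) :
    tI q ν (q⁻¹ * z) 0 = q ^ (-ν) * tI q ν z 0 := by
  unfold tI
  simp only [Nat.cast_zero, mul_zero, add_zero]
  rw [show q⁻¹ * z / 2 = q⁻¹ * (z / 2) by ring, Real.mul_rpow (by positivity) (by positivity),
      Real.inv_rpow hq0.le, Real.rpow_neg hq0.le]
  ring

lemma tI_ratio (q : ℝ) (hq0 : 0 < q) (hq1 : q < 1) (ν z : ℝ) (hz : 0 < z) (k : ℕ) :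
    tI q ν z (k+1) * ((1 - q ^ 2 * q ^ (2 * (k:ℝ))) * (1 - q ^ (2 * (ν + 1)) * (q ^ 2) ^ k)) =
      tI q ν z k * ((q ^ (2 * (ν + 1)) * (1 - q ^ 2) ^ 2 * (z / 2) ^ 2) * (q ^ 4) ^ k) := by
  have hp' : 0 < 1 - q ^ 2 := by nlinarith
  unfold tI
  push_cast
  have a1 : q ^ (2 * ((k : ℝ)+1) * (ν + (k+1))) =
      q ^ (2 * (k : ℝ) * (ν + k)) * (q ^ (2 * (ν + 1)) * (q ^ 4) ^ k) := by
    rw [← pow_mul, ← Real.rpow_natCast q (4 * k)]; simp only [← Real.rpow_add hq0]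
    push_cast; ring_nf
  have a2 : (z / 2) ^ (ν + 2 * ((k : ℝ) + 1)) = (z / 2) ^ (ν + 2 * (k : ℝ)) * (z / 2) ^ 2 := by
    rw [← Real.rpow_natCast (z / 2) 2, ← Real.rpow_add (by positivity)]; push_cast; ring_nf
  have a4 : (qGamma2 q (ν + k + 1))⁻¹ = (qGamma2 q (ν + (k + 1) + 1))⁻¹ *
      ((1 - q ^ (2 * (ν + 1)) * (q ^ 2) ^ k) / (1 - q ^ 2)) := by
    rw [gam_rec q hq0 hq1, ← pow_mul, ← Real.rpow_natCast q (2 * k), ← Real.rpow_add hq0]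
    push_cast; ring_nf
  simp only [div_eq_mul_inv _ (qPochR _ _ _ * _), mul_inv (qPochR _ _ _)]
  rw [a1, a2, a4, (poch_succ q hq0 hq1 k).1]
  generalize (qGamma2 q (ν + (k + 1) + 1))⁻¹ = G
  generalize (qPochR (q ^ 2) (q ^ 2) (k+1))⁻¹ = P
  rw [pow_succ (1 - q ^ 2) k]
  field_simp

lemma tI_summable (q : ℝ) (hq0 : 0 < q) (hq1 : q < 1) (ν z : ℝ) (hz : 0 < z) :
    Summable (tI q ν z) := by
  have hp' : 0 < 1 - q ^ 2 := by nlinarith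
  have l1 : Filter.Tendsto (fun k : ℕ => q ^ (2 * (ν + 1)) * (q ^ 2) ^ k) Filter.atTop (nhds 0) := by
    simpa using (tendsto_pow_atTop_nhds_zero_of_lt_one (sq_nonneg q) (by linarith)).const_mul
      (q ^ (2 * (ν + 1)))
  have l2 : Filter.Tendsto (fun k : ℕ => (q ^ (2 * (ν + 1)) * (1 - q ^ 2) ^ 2 * (z / 2) ^ 2) *
      (q ^ 4) ^ k) Filter.atTop (nhds 0) := by
    simpa using (tendsto_pow_atTop_nhds_zero_of_lt_one (r := q ^ 4) (by positivity)
      (pow_lt_one₀ hq0.le hq1 (by norm_num))).const_mul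
      (q ^ (2 * (ν + 1)) * (1 - q ^ 2) ^ 2 * (z / 2) ^ 2)
  refine summable_of_ratio_norm_eventually_le (r := 1 / 2) (by norm_num) ?_
  filter_upwards [l1.eventually_le_const (u := 1 / 2) (by norm_num),
    l2.eventually_le_const (u := (1 - q ^ 2) / 4) (by positivity)] with k h1 h2
  have hr := congrArg norm (tI_ratio q hq0 hq1 ν z hz k)
  have hb := (poch_succ q hq0 hq1 k).2
  have hc : (1 - q ^ 2) / 2 ≤
      (1 - q ^ 2 * q ^ (2 * (k:ℝ))) * (1 - q ^ (2 * (ν + 1)) * (q ^ 2) ^ k) := by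
    nlinarith
  have hd : 0 ≤ (q ^ (2 * (ν + 1)) * (1 - q ^ 2) ^ 2 * (z / 2) ^ 2) * (q ^ 4) ^ k := by
    positivity
  rw [norm_mul, norm_mul (tI q ν z k), Real.norm_of_nonneg (by linarith : 0 ≤ (1 - q ^ 2 * q ^ (2 * (k:ℝ))) * (1 - q ^ (2 * (ν + 1)) * (q ^ 2) ^ k)),
    Real.norm_of_nonneg hd] at hr
  have x1 := mul_le_mul_of_nonneg_left hc (norm_nonneg (tI q ν z (k+1)))
  have x2 := mul_le_mul_of_nonneg_left h2 (norm_nonneg (tI q ν z k))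
  have : ‖tI q ν z (k+1)‖ * (1 - q ^ 2) ≤ (1 / 2 * ‖tI q ν z k‖) * (1 - q ^ 2) := by linarith
  exact le_of_mul_le_mul_right this hp'

/-- The recurrence relations for `I^{(2)}`:
`q^{-ν} I^{(2)}_{ν-1}((1-q²)z;q²) - q^ν I^{(2)}_{ν+1}((1-q²)z;q²)
   = (2/((1-q²)z))(q^{-ν}-q^ν) I^{(2)}_ν((1-q²)z;q²)` and
`q^{-ν} I^{(2)}_{ν-1}((1-q²)z;q²) + q^ν I^{(2)}_{ν+1}((1-q²)z;q²)
   = (4/((1-q²)z)) I^{(2)}_ν((1-q²)q^{-1}z;q²) - (2/((1-q²)z))(q^{-ν}+q^ν) I^{(2)}_ν((1-q²)z;q²)`. -/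
theorem stmt8 (q : ℝ) (hq0 : 0 < q) (hq1 : q < 1) (ν : ℝ)
    (h1 : ∀ m : ℤ, m < 0 → ν ≠ m) (h2 : ∀ m : ℤ, m < 0 → ν - 1 ≠ m)
    (h3 : ∀ m : ℤ, m < 0 → ν + 1 ≠ m)
    (z : ℝ) (hz0 : 0 < z) :
    q ^ (-ν) * I2 q (ν - 1) z - q ^ ν * I2 q (ν + 1) z
        = (2 / ((1 - q ^ 2) * z)) * (q ^ (-ν) - q ^ ν) * I2 q ν z ∧
    q ^ (-ν) * I2 q (ν - 1) z + q ^ ν * I2 q (ν + 1) z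
        = (4 / ((1 - q ^ 2) * z)) * I2 q ν (q⁻¹ * z)
          - (2 / ((1 - q ^ 2) * z)) * (q ^ (-ν) + q ^ ν) * I2 q ν z := by
  have hz' : 0 < q⁻¹ * z := by positivity
  have S0 := tI_summable q hq0 hq1 ν z hz0
  have S1 := tI_summable q hq0 hq1 ν (q⁻¹ * z) hz'
  have e : ∀ μ y, I2 q μ y = ∑' k, tI q μ y k := fun _ _ => rfl
  have d : q ^ (-ν) * I2 q (ν - 1) z =
      2 / ((1 - q ^ 2) * z) * (I2 q ν (q⁻¹ * z) - q ^ ν * I2 q ν z) := by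
    simp only [e]
    rw [← tsum_mul_left, tsum_congr (tI_down q hq0 hq1 ν z hz0), tsum_mul_left,
      S1.tsum_sub (S0.mul_left _), tsum_mul_left]
  have u : q ^ ν * I2 q (ν + 1) z =
      2 / ((1 - q ^ 2) * z) * (I2 q ν (q⁻¹ * z) - q ^ (-ν) * I2 q ν z) := by
    simp only [e]
    rw [← tsum_mul_left, tsum_congr (tI_up q hq0 hq1 ν z hz0), tsum_mul_left,
      ← tsum_mul_left (a := q ^ (-ν)), ← S1.tsum_sub (S0.mul_left _),
      (S1.sub (S0.mul_left _)).tsum_eq_zero_add, tI_zero q hq0 ν z hz0, sub_self, zero_add]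
  rw [d, u]
  constructor <;> ring
end

section
/- Let 0 < q < 1 be real, let ν be a real number that is not a negative integer, and let z be real with 0 < z < 2/(1−q²). Then I^{(1)}_ν((1−q²)z; q²) = e_{q²}((1−q²)² z²/4) · I^{(2)}_ν((1−q²)z; q²). -/
/-- The q²-exponential `e_{q²}(w) = 1/(w;q²)_∞`. -/
noncomputable def qExp2R (q w : ℝ) : ℝ := 1 / qPochInfR w (q ^ 2)

lemma aux_qp_pos {p : ℝ} (h0 : 0 < p) (h1 : p < 1) (n : ℕ) : 0 < qPochR p p n := by
  unfold qPochR
  refine Finset.prod_pos fun j _ => ?_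
  have : p * p ^ j < 1 := by
    rw [← pow_succ']
    exact pow_lt_one₀ h0.le h1 (by simp)
  linarith

lemma aux_qp_succ (p : ℝ) (n : ℕ) :
    qPochR p p (n + 1) = qPochR p p n * (1 - p ^ (n + 1)) := by
  unfold qPochR
  rw [Finset.prod_range_succ, pow_succ' p n]

lemma aux_qp_succ' (a p : ℝ) (n : ℕ) :
    qPochR a p (n + 1) = (1 - a) * qPochR (a * p) p n := by
  unfold qPochR
  rw [Finset.prod_range_succ', mul_comm]
  congr 1
  · simp
  · refine Finset.prod_congr rfl fun j _ => ?_
    ring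

lemma aux_finite {p : ℝ} (h0 : 0 < p) (h1 : p < 1) (n : ℕ) : ∀ a : ℝ,
    ∑ x ∈ Finset.HasAntidiagonal.antidiagonal n, p ^ (x.1 * x.1) * a ^ x.1 * qPochR (a * p ^ (x.1 + 1)) p x.2 /
      (qPochR p p x.1 * qPochR p p x.2) = 1 / qPochR p p n := by
  induction n with
  | zero => intro a; simp [qPochR]
  | succ n ih =>
    intro a
    have hn1 : (1 - p ^ (n + 1)) ≠ 0 := by
      have : p ^ (n + 1) < 1 := pow_lt_one₀ h0.le h1 (by simp)
      linarith
    have key : (1 - p ^ (n + 1)) * ∑ x ∈ Finset.HasAntidiagonal.antidiagonal (n + 1),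
        p ^ (x.1 * x.1) * a ^ x.1 * qPochR (a * p ^ (x.1 + 1)) p x.2 /
        (qPochR p p x.1 * qPochR p p x.2) = 1 / qPochR p p n := by
      rw [← ih (a * p), Finset.mul_sum]
      have e1 : ∀ x ∈ Finset.HasAntidiagonal.antidiagonal (n + 1), (1 - p ^ (n + 1)) *
          (p ^ (x.1 * x.1) * a ^ x.1 * qPochR (a * p ^ (x.1 + 1)) p x.2 /
          (qPochR p p x.1 * qPochR p p x.2)) =
          (1 - p ^ x.2) * p ^ x.1 *
          (p ^ (x.1 * x.1) * a ^ x.1 * qPochR (a * p ^ (x.1 + 1)) p x.2 /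
          (qPochR p p x.1 * qPochR p p x.2)) + (1 - p ^ x.1) *
          (p ^ (x.1 * x.1) * a ^ x.1 * qPochR (a * p ^ (x.1 + 1)) p x.2 /
          (qPochR p p x.1 * qPochR p p x.2)) := by
        intro x hx
        rw [← Finset.HasAntidiagonal.mem_antidiagonal.mp hx, pow_add]
        ring
      rw [Finset.sum_congr rfl e1, Finset.sum_add_distrib, Finset.Nat.sum_antidiagonal_succ',
        Finset.Nat.sum_antidiagonal_succ]
      simp only [pow_zero, sub_self, zero_mul, zero_add]
      rw [← Finset.sum_add_distrib]
      refine Finset.sum_congr rfl fun x _ => ?_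
      obtain ⟨k, m⟩ := x
      simp only
      have hk := (aux_qp_pos h0 h1 k).ne'
      have hm := (aux_qp_pos h0 h1 m).ne'
      have hk1 : (1 - p ^ (k + 1)) ≠ 0 := by
        have : p ^ (k + 1) < 1 := pow_lt_one₀ h0.le h1 (by simp)
        linarith
      have hm1 : (1 - p ^ (m + 1)) ≠ 0 := by
        have : p ^ (m + 1) < 1 := pow_lt_one₀ h0.le h1 (by simp)
        linarith
      rw [aux_qp_succ p k, aux_qp_succ p m, aux_qp_succ' (a * p ^ (k + 1)) p m]
      have e2 : a * p ^ (k + 1) * p = a * p * p ^ (k + 1) := by ring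
      have e3 : a * p ^ (k + 1 + 1) = a * p * p ^ (k + 1) := by ring
      rw [e2, e3]
      generalize qPochR (a * p * p ^ (k + 1)) p m = Q
      generalize qPochR p p k = K at *
      generalize qPochR p p m = M at *
      have t1 : (1 - p ^ (m + 1)) * p ^ k * (p ^ (k * k) * a ^ k * ((1 - a * p ^ (k + 1)) * Q) /
          (K * (M * (1 - p ^ (m + 1))))) =
          p ^ k * (p ^ (k * k) * a ^ k * ((1 - a * p ^ (k + 1)) * Q)) / (K * M) := by
        field_simp
      have t2 : (1 - p ^ (k + 1)) * (p ^ ((k + 1) * (k + 1)) * a ^ (k + 1) * Q /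
          (K * (1 - p ^ (k + 1)) * M)) =
          (p ^ ((k + 1) * (k + 1)) * a ^ (k + 1) * Q) / (K * M) := by
        field_simp
      rw [t1, t2, ← add_div]
      congr 1
      have e4 : p ^ ((k + 1) * (k + 1)) = p ^ (k * k) * p ^ k * p ^ (k + 1) := by
        rw [← pow_add, ← pow_add]; congr 1; ring
      rw [e4, mul_pow]
      ring
    rw [aux_qp_succ, one_div, mul_inv, ← one_div, ← key]
    field_simp

lemma aux_mult {p : ℝ} (h0 : 0 < p) (h1 : p < 1) (c : ℝ) :
    Multipliable (fun j : ℕ => 1 - c * p ^ j) := by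
  have := Real.multipliable_one_add_of_summable (f := fun j : ℕ => -(c * p ^ j))
    ((summable_geometric_of_lt_one h0.le h1).mul_left c).neg
  simpa [sub_eq_add_neg] using this

lemma aux_split {p : ℝ} (h0 : 0 < p) (h1 : p < 1) (c : ℝ) (m : ℕ) :
    qPochInfR c p = qPochR c p m * qPochInfR (c * p ^ m) p := by
  unfold qPochInfR qPochR
  have e : (fun j : ℕ => 1 - c * p ^ m * p ^ j) = fun j : ℕ => 1 - c * p ^ (j + m) := by
    funext j; rw [pow_add]; ring
  have hm := aux_mult h0 h1 (c * p ^ m)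
  rw [e] at hm
  rw [e]
  exact (Multipliable.prod_mul_tprod_nat_mul' (f := fun j : ℕ => 1 - c * p ^ j) hm).symm

lemma aux_bound {p : ℝ} (h0 : 0 < p) (h1 : p < 1) (c : ℝ) (hc : 0 ≤ c) :
    |qPochInfR c p| ≤ Real.exp (c * (1 - p)⁻¹) := by
  have ht := ((aux_mult h0 h1 c).tendsto_prod_tprod_nat).abs
  refine le_of_tendsto' ht fun n => ?_
  rw [Finset.abs_prod]
  have hs := (summable_geometric_of_lt_one h0.le h1).mul_left c
  calc ∏ j ∈ Finset.range n, |1 - c * p ^ j| ≤ ∏ j ∈ Finset.range n, (1 + c * p ^ j) := by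
        refine Finset.prod_le_prod (fun _ _ => abs_nonneg _) fun j _ => ?_
        have : 0 ≤ c * p ^ j := by positivity
        rw [abs_le]; constructor <;> linarith
    _ ≤ Real.exp (∑ j ∈ Finset.range n, c * p ^ j) :=
        Real.prod_one_add_le_exp_sum _ (fun j => by positivity)
    _ ≤ Real.exp (c * (1 - p)⁻¹) := by
        rw [Real.exp_le_exp, ← tsum_geometric_of_lt_one h0.le h1, ← tsum_mul_left]
        exact hs.sum_le_tsum _ (fun j _ => by positivity)

lemma aux_tend {p : ℝ} (h0 : 0 < p) (h1 : p < 1) :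
    Filter.Tendsto (fun n : ℕ => (1 - p ^ (n + 1))⁻¹) Filter.atTop (nhds 1) := by
  have h := (tendsto_pow_atTop_nhds_zero_of_lt_one h0.le h1).comp (Filter.tendsto_add_atTop_nat 1)
  have h2 := (h.const_sub 1).inv₀ (by norm_num)
  simpa using h2

lemma aux_sumE {p x : ℝ} (h0 : 0 < p) (h1 : p < 1) (hx0 : 0 < x) (hx : x < 1) :
    Summable (fun n : ℕ => x ^ n / qPochR p p n) := by
  refine summable_of_ratio_test_tendsto_lt_one hx ?_ ?_
  · exact Filter.Eventually.of_forall fun n =>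
      (div_pos (pow_pos hx0 n) (aux_qp_pos h0 h1 n)).ne'
  · have h := (aux_tend h0 h1).const_mul x
    rw [mul_one] at h
    refine h.congr fun n => ?_
    have hp := aux_qp_pos h0 h1 n
    have hp1 := aux_qp_pos h0 h1 (n + 1)
    rw [Real.norm_of_nonneg (by positivity), Real.norm_of_nonneg (by positivity)]
    have hk1 : (1 - p ^ (n + 1)) ≠ 0 := by
      have : p ^ (n + 1) < 1 := pow_lt_one₀ h0.le h1 (by simp)
      linarith
    rw [aux_qp_succ, pow_succ x]
    field_simp

lemma aux_sumG {p y : ℝ} (h0 : 0 < p) (h1 : p < 1) (hy : 0 < y) :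
    Summable (fun k : ℕ => p ^ (k * k) * y ^ k / qPochR p p k) := by
  refine summable_of_ratio_test_tendsto_lt_one (l := 0) one_pos ?_ ?_
  · exact Filter.Eventually.of_forall fun n =>
      (div_pos (by positivity) (aux_qp_pos h0 h1 n)).ne'
  · have hz := tendsto_pow_atTop_nhds_zero_of_lt_one h0.le h1
    have h := ((hz.mul hz).mul (aux_tend h0 h1)).const_mul (y * p)
    simp only [mul_zero, zero_mul] at h
    refine h.congr fun n => ?_
    have hp := aux_qp_pos h0 h1 n
    have hp1 := aux_qp_pos h0 h1 (n + 1)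
    rw [Real.norm_of_nonneg (by positivity), Real.norm_of_nonneg (by positivity)]
    have hk1 : (1 - p ^ (n + 1)) ≠ 0 := by
      have : p ^ (n + 1) < 1 := pow_lt_one₀ h0.le h1 (by simp)
      linarith
    have e4 : p ^ ((n + 1) * (n + 1)) = p ^ (n * n) * (p ^ n * p ^ n * p) := by
      rw [← pow_add, ← pow_succ, ← pow_add]; congr 1; ring
    rw [aux_qp_succ, e4, pow_succ y]
    have : p ^ (n * n) ≠ 0 := by positivity
    generalize p ^ (n * n) = A at *
    generalize 1 - p ^ (n + 1) = B at *
    generalize p ^ n = D at *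
    field_simp

lemma aux_Estep {p x : ℝ} (h0 : 0 < p) (h1 : p < 1) (hx0 : 0 < x) (hx : x < 1) :
    (1 - x) * ∑' n : ℕ, x ^ n / qPochR p p n = ∑' n : ℕ, (p * x) ^ n / qPochR p p n := by
  have hs := aux_sumE h0 h1 hx0 hx
  have hs2 := aux_sumE h0 h1 (mul_pos h0 hx0) (by nlinarith : p * x < 1)
  have e : ∑' n : ℕ, x ^ n / qPochR p p n - ∑' n : ℕ, (p * x) ^ n / qPochR p p n =
      x * ∑' n : ℕ, x ^ n / qPochR p p n := by
    rw [← hs.tsum_sub hs2, (hs.sub hs2).tsum_eq_zero_add, ← tsum_mul_left]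
    simp only [pow_zero, sub_self, zero_add]
    refine tsum_congr fun n => ?_
    have hp := (aux_qp_pos h0 h1 n).ne'
    have hk1 : (1 - p ^ (n + 1)) ≠ 0 := by
      have : p ^ (n + 1) < 1 := pow_lt_one₀ h0.le h1 (by simp)
      linarith
    rw [aux_qp_succ, mul_pow, ← sub_div]
    have : x ^ (n + 1) - p ^ (n + 1) * x ^ (n + 1) = x * x ^ n * (1 - p ^ (n + 1)) := by ring
    rw [this]
    field_simp
  linarith

lemma aux_Eiter {p x : ℝ} (h0 : 0 < p) (h1 : p < 1) (hx0 : 0 < x) (hx : x < 1) (N : ℕ) :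
    qPochR x p N * ∑' n : ℕ, x ^ n / qPochR p p n =
      ∑' n : ℕ, (x * p ^ N) ^ n / qPochR p p n := by
  induction N with
  | zero => simp [qPochR]
  | succ N ih =>
    have hN : p ^ N ≤ 1 := pow_le_one₀ h0.le h1.le
    have hN0 : 0 < p ^ N := by positivity
    have := aux_Estep h0 h1 (mul_pos hx0 hN0) (by nlinarith)
    rw [← ih] at this
    have e : x * p ^ (N + 1) = p * (x * p ^ N) := by ring
    rw [e, ← this]
    unfold qPochR
    rw [Finset.prod_range_succ]
    ring

lemma aux_Euler {p x : ℝ} (h0 : 0 < p) (h1 : p < 1) (hx0 : 0 < x) (hx : x < 1) :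
    qPochInfR x p * ∑' n : ℕ, x ^ n / qPochR p p n = 1 := by
  have hl := ((aux_mult h0 h1 x).tendsto_prod_tprod_nat).mul_const
    (∑' n : ℕ, x ^ n / qPochR p p n)
  refine tendsto_nhds_unique hl ?_
  have hr : Filter.Tendsto (fun N : ℕ => ∑' n : ℕ, (x * p ^ N) ^ n / qPochR p p n)
      Filter.atTop (nhds (∑' n : ℕ, (0 : ℝ) ^ n / qPochR p p n)) := by
    refine tendsto_tsum_of_dominated_convergence (aux_sumE h0 h1 hx0 hx) ?_ ?_
    · intro n
      have hz := (tendsto_pow_atTop_nhds_zero_of_lt_one h0.le h1).const_mul x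
      rw [mul_zero] at hz
      exact (hz.pow n).div_const _
    · refine Filter.Eventually.of_forall fun N n => ?_
      have hp := aux_qp_pos h0 h1 n
      rw [Real.norm_of_nonneg (by positivity)]
      have hN : p ^ N ≤ 1 := pow_le_one₀ h0.le h1.le
      have : x * p ^ N ≤ x := by nlinarith
      gcongr
  have hz : ∑' n : ℕ, (0 : ℝ) ^ n / qPochR p p n = 1 := by
    rw [tsum_eq_single 0]
    · simp [qPochR]
    · intro n hn; simp [hn]
  rw [hz] at hr
  refine hr.congr fun N => ?_
  rw [← aux_Eiter h0 h1 hx0 hx N]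
  rfl

lemma aux_main {p x a : ℝ} (h0 : 0 < p) (h1 : p < 1) (hx0 : 0 < x) (hx : x < 1) (ha : 0 < a) :
    ∑' k : ℕ, x ^ k * qPochInfR (a * p ^ (k + 1)) p / qPochR p p k =
      1 / qPochInfR x p * ∑' k : ℕ, p ^ (k * k) * a ^ k * x ^ k *
        qPochInfR (a * p ^ (k + 1)) p / qPochR p p k := by
  have hE := aux_Euler h0 h1 hx0 hx
  have hne : qPochInfR x p ≠ 0 := left_ne_zero_of_mul_eq_one hE
  have hE' : 1 / qPochInfR x p = ∑' n : ℕ, x ^ n / qPochR p p n := by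
    rw [div_eq_iff hne, mul_comm]; exact hE.symm
  have hsG : Summable (fun k : ℕ => ‖p ^ (k * k) * a ^ k * x ^ k *
        qPochInfR (a * p ^ (k + 1)) p / qPochR p p k‖) := by
    refine Summable.of_nonneg_of_le (fun _ => norm_nonneg _) (fun k => ?_)
      ((aux_sumG h0 h1 (mul_pos ha hx0)).mul_left (Real.exp (a * (1 - p)⁻¹)))
    have hp := aux_qp_pos h0 h1 k
    have hb := aux_bound h0 h1 (a * p ^ (k + 1)) (by positivity)
    have hb2 : Real.exp (a * p ^ (k + 1) * (1 - p)⁻¹) ≤ Real.exp (a * (1 - p)⁻¹) := by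
      rw [Real.exp_le_exp]
      have : 0 ≤ (1 - p)⁻¹ := inv_nonneg.mpr (by linarith)
      refine mul_le_mul_of_nonneg_right ?_ this
      have : p ^ (k + 1) ≤ 1 := pow_le_one₀ h0.le h1.le
      nlinarith
    rw [norm_div, norm_mul, Real.norm_of_nonneg hp.le,
      Real.norm_of_nonneg (by positivity : 0 ≤ p ^ (k * k) * a ^ k * x ^ k), Real.norm_eq_abs,
      mul_pow, ← mul_div_assoc]
    refine div_le_div_of_nonneg_right ?_ hp.le
    calc _ ≤ p ^ (k * k) * a ^ k * x ^ k * Real.exp (a * (1 - p)⁻¹) :=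
          mul_le_mul_of_nonneg_left (hb.trans hb2) (by positivity)
      _ = _ := by ring
  rw [hE', mul_comm, tsum_mul_tsum_eq_tsum_sum_antidiagonal_of_summable_norm hsG
    (aux_sumE h0 h1 hx0 hx).norm]
  refine tsum_congr fun n => ?_
  have hf := aux_finite h0 h1 n a
  have : x ^ n * qPochInfR (a * p ^ (n + 1)) p / qPochR p p n =
      x ^ n * qPochInfR (a * p ^ (n + 1)) p * (1 / qPochR p p n) := by ring
  rw [this, ← hf, Finset.mul_sum]
  refine Finset.sum_congr rfl fun y hy => ?_
  obtain ⟨k, m⟩ := y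
  have hkm := Finset.HasAntidiagonal.mem_antidiagonal.mp hy
  simp only at hkm ⊢
  rw [aux_split h0 h1 (a * p ^ (k + 1)) m, ← hkm]
  have e : a * p ^ (k + 1) * p ^ m = a * p ^ (k + m + 1) := by
    rw [mul_assoc, ← pow_add]; congr 2; ring
  rw [e, pow_add x]
  have hk := (aux_qp_pos h0 h1 k).ne'
  have hm := (aux_qp_pos h0 h1 m).ne'
  field_simp

lemma aux_term {q ν z : ℝ} (hq0 : 0 < q) (hq1 : q < 1) (hz0 : 0 < z) (k : ℕ) :
    (1 - q ^ 2) ^ k * (z / 2) ^ (ν + 2 * (k : ℝ)) /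
    (qPochR (q ^ 2) (q ^ 2) k * qGamma2 q (ν + k + 1)) =
    ((z / 2) ^ ν * (1 - q ^ 2) ^ ν / qPochInfR (q ^ 2) (q ^ 2)) *
    (((1 - q ^ 2) ^ 2 * z ^ 2 / 4) ^ k *
      qPochInfR (Real.exp (2 * ν * Real.log q) * (q ^ 2) ^ (k + 1)) (q ^ 2) /
      qPochR (q ^ 2) (q ^ 2) k) := by
  have hp : 0 < 1 - q ^ 2 := by nlinarith
  unfold qGamma2
  have e1 : Real.exp (2 * (ν + k + 1) * Real.log q) =
      Real.exp (2 * ν * Real.log q) * (q ^ 2) ^ (k + 1) := by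
    have : (q ^ 2) ^ (k + 1) = Real.exp (((2 * (k + 1) : ℕ) : ℝ) * Real.log q) := by
      rw [Real.exp_nat_mul, Real.exp_log hq0, pow_mul]
    rw [this, ← Real.exp_add]
    congr 1; push_cast; ring
  have e2 : (1 - q ^ 2) ^ (1 - (ν + k + 1)) = ((1 - q ^ 2) ^ ν * (1 - q ^ 2) ^ k)⁻¹ := by
    rw [← Real.rpow_natCast (1 - q ^ 2) k, ← Real.rpow_add hp, ← Real.rpow_neg hp.le]
    congr 1; ring
  have e3 : (z / 2) ^ (ν + 2 * (k : ℝ)) = (z / 2) ^ ν * ((z / 2) ^ 2) ^ k := by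
    rw [Real.rpow_add (by positivity), ← pow_mul, ← Real.rpow_natCast (z / 2) (2 * k)]
    push_cast; rfl
  have e4 : ((1 - q ^ 2) ^ 2 * z ^ 2 / 4) ^ k =
      (1 - q ^ 2) ^ k * (1 - q ^ 2) ^ k * ((z / 2) ^ 2) ^ k := by
    have : (1 - q ^ 2) ^ 2 * z ^ 2 / 4 = (1 - q ^ 2) * (1 - q ^ 2) * (z / 2) ^ 2 := by ring
    rw [this, mul_pow, mul_pow]
  rw [e1, e2, e3, e4]
  simp only [div_eq_mul_inv, mul_inv, inv_inv]
  ring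

/-- Relation (3.16): `I^{(1)}_ν((1-q²)z;q²) = e_{q²}((1-q²)²z²/4) I^{(2)}_ν((1-q²)z;q²)`. -/
theorem stmt12 (q : ℝ) (hq0 : 0 < q) (hq1 : q < 1) (ν : ℝ)
    (hν : ∀ m : ℤ, m < 0 → ν ≠ m)
    (z : ℝ) (hz0 : 0 < z) (hz : z < 2 / (1 - q ^ 2)) :
    I1 q ν z = qExp2R q ((1 - q ^ 2) ^ 2 * z ^ 2 / 4) * I2 q ν z := by
  have hp0 : 0 < q ^ 2 := by positivity
  have hp1 : q ^ 2 < 1 := by nlinarith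
  have hp : 0 < 1 - q ^ 2 := by linarith
  have hx0 : 0 < (1 - q ^ 2) ^ 2 * z ^ 2 / 4 := by positivity
  have hx : (1 - q ^ 2) ^ 2 * z ^ 2 / 4 < 1 := by
    rw [lt_div_iff₀ hp] at hz
    have h3 : 0 < z * (1 - q ^ 2) := by positivity
    nlinarith
  have hm := aux_main hp0 hp1 hx0 hx (Real.exp_pos (2 * ν * Real.log q))
  unfold I1 I2 qExp2R
  have e2 : ∀ k : ℕ, q ^ (2 * (k : ℝ) * (ν + k)) * (1 - q ^ 2) ^ k *
      (z / 2) ^ (ν + 2 * (k : ℝ)) / (qPochR (q ^ 2) (q ^ 2) k * qGamma2 q (ν + k + 1)) =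
      ((z / 2) ^ ν * (1 - q ^ 2) ^ ν / qPochInfR (q ^ 2) (q ^ 2)) *
      ((q ^ 2) ^ (k * k) * Real.exp (2 * ν * Real.log q) ^ k *
      ((1 - q ^ 2) ^ 2 * z ^ 2 / 4) ^ k *
      qPochInfR (Real.exp (2 * ν * Real.log q) * (q ^ 2) ^ (k + 1)) (q ^ 2) /
      qPochR (q ^ 2) (q ^ 2) k) := by
    intro k
    have e : q ^ (2 * (k : ℝ) * (ν + k)) =
        (q ^ 2) ^ (k * k) * Real.exp (2 * ν * Real.log q) ^ k := by
      have : (q ^ 2) ^ (k * k) = Real.exp (((2 * (k * k) : ℕ) : ℝ) * Real.log q) := by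
        rw [Real.exp_nat_mul, Real.exp_log hq0, ← pow_mul]
      rw [this, ← Real.exp_nat_mul, ← Real.exp_add, Real.rpow_def_of_pos hq0]
      congr 1; push_cast; ring
    rw [mul_assoc, mul_div_assoc, aux_term hq0 hq1 hz0 k, e]
    ring
  rw [tsum_congr (fun k => aux_term hq0 hq1 hz0 k), tsum_congr e2, tsum_mul_left, tsum_mul_left, hm]
  ring
end

section
/- Let 0 < q < 1 be real, let ν be a real number that is not a negative integer, and let z be real with 0 < z < 2/(1−q²). Then I^{(2)}_ν((1−q²)z; q²) = E_{q²}(−(1−q²)² z²/4) · I^{(1)}_ν((1−q²)z; q²), where E_{q²}(w) = (−w; q²)_∞. -/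
/-- The second q²-exponential `E_{q²}(w) = (-w;q²)_∞`. -/
noncomputable def qExpE2R (q w : ℝ) : ℝ := qPochInfR (-w) (q ^ 2)

open Filter Topology

namespace QB

noncomputable def e (p : ℝ) (j : ℕ) : ℝ := (-1) ^ j * p ^ (j * (j - 1) / 2) / qPochR p p j

noncomputable def f (a p : ℝ) (j : ℕ) : ℝ := 1 / (qPochR a p j * qPochR p p j)

noncomputable def g (a p : ℝ) (j : ℕ) : ℝ := p ^ (j * (j - 1)) * a ^ j / (qPochR a p j * qPochR p p j)

lemma poch_succ (a p : ℝ) (n : ℕ) : qPochR a p (n + 1) = qPochR a p n * (1 - a * p ^ n) := by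
  simp [qPochR, Finset.prod_range_succ]

lemma poch_ne (a p : ℝ) (h : ∀ n : ℕ, 1 - a * p ^ n ≠ 0) (n : ℕ) : qPochR a p n ≠ 0 := by
  unfold qPochR
  exact Finset.prod_ne_zero_iff.mpr fun j _ => h j

lemma pp_ne (p : ℝ) (h0 : 0 < p) (h1 : p < 1) (n : ℕ) : 1 - p * p ^ n ≠ 0 := by
  have : p ^ n ≤ 1 := pow_le_one₀ h0.le h1.le
  have : p * p ^ n < 1 := by nlinarith
  linarith

lemma mult (a p : ℝ) (h0 : 0 < p) (h1 : p < 1) : Multipliable fun j : ℕ => (1 - a * p ^ j) := by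
  have := multipliable_one_add_of_summable (f := fun j : ℕ => - (a * p ^ j)) (by
    simp only [norm_neg]
    exact ((summable_geometric_of_lt_one h0.le h1).mul_left a).norm)
  simpa [sub_eq_add_neg] using this

lemma inf_split (a p : ℝ) (h0 : 0 < p) (h1 : p < 1) (k : ℕ) :
    qPochInfR a p = qPochR a p k * qPochInfR (a * p ^ k) p := by
  have h := mult (a * p ^ k) p h0 h1
  have h2 : (fun j : ℕ => (1 - a * p ^ k * p ^ j)) = fun j => (1 - a * p ^ (j + k)) := by
    funext j; rw [pow_add]; ring
  unfold qPochInfR qPochR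
  rw [h2] at h ⊢
  exact (h.prod_mul_tprod_nat_mul' (f := fun j : ℕ => (1 - a * p ^ j))).symm

lemma e_succ (p : ℝ) (h0 : 0 < p) (h1 : p < 1) (j : ℕ) :
    e p (j + 1) * (1 - p * p ^ j) = - p ^ j * e p j := by
  have hp := poch_ne p p (pp_ne p h0 h1) j
  have hj := pp_ne p h0 h1 j
  have hx : (j + 1) * (j + 1 - 1) / 2 = j * (j - 1) / 2 + j := by
    rw [Nat.triangle_succ]
  unfold e
  rw [poch_succ, hx, pow_add, pow_succ]
  generalize 1 - p * p ^ j = t at hj ⊢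
  field_simp
  rw [pow_add]
  ring

lemma f_succ (a p : ℝ) (h0 : 0 < p) (h1 : p < 1) (h : ∀ n : ℕ, 1 - a * p ^ n ≠ 0) (j : ℕ) :
    f a p (j + 1) * ((1 - p * p ^ j) * (1 - a * p ^ j)) = f a p j := by
  have hp := poch_ne p p (pp_ne p h0 h1) j
  have hj := pp_ne p h0 h1 j
  have hp' := poch_ne a p h j
  have hj' := h j
  unfold f
  rw [poch_succ, poch_succ]
  generalize 1 - p * p ^ j = t at hj ⊢
  generalize 1 - a * p ^ j = u at hj' ⊢
  field_simp

lemma g_succ (a p : ℝ) (h0 : 0 < p) (h1 : p < 1) (h : ∀ n : ℕ, 1 - a * p ^ n ≠ 0) (j : ℕ) :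
    g a p (j + 1) * ((1 - p * p ^ j) * (1 - a * p ^ j)) = a * p ^ (2 * j) * g a p j := by
  have hp := poch_ne p p (pp_ne p h0 h1) j
  have hj := pp_ne p h0 h1 j
  have hp' := poch_ne a p h j
  have hj' := h j
  have hx : (j + 1) * (j + 1 - 1) = j * (j - 1) + 2 * j := by
    cases j <;> simp <;> ring
  unfold g
  rw [poch_succ, poch_succ, hx, pow_add, pow_succ]
  generalize 1 - p * p ^ j = t at hj ⊢
  generalize 1 - a * p ^ j = u at hj' ⊢
  field_simp

open PowerSeries in
lemma conv (a p : ℝ) (h0 : 0 < p) (h1 : p < 1) (h : ∀ n : ℕ, 1 - a * p ^ n ≠ 0) :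
    PowerSeries.mk (e p) * PowerSeries.mk (f a p) = PowerSeries.mk (g a p) := by
  set E := PowerSeries.mk (e p) with hE
  set F := PowerSeries.mk (f a p) with hF
  have e1 : E = (1 - X) * rescale p E := by
    ext n
    rw [sub_mul, one_mul, map_sub]
    cases n with
    | zero => simp [hE]
    | succ n =>
      rw [coeff_succ_X_mul]
      simp only [hE, coeff_rescale, coeff_mk]
      have := e_succ p h0 h1 n
      rw [pow_succ]; linarith
  have e2 : rescale p E = (1 - C p * X) * rescale p (rescale p E) := by
    conv_lhs => rw [e1]
    rw [map_mul, map_sub, map_one, rescale_X]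
  have f1 : (1 - X) * (C p * F) = (C p + C a) * rescale p F - C a * rescale p (rescale p F) := by
    ext n
    rw [sub_mul, one_mul, map_sub, map_sub, add_mul, map_add]
    cases n with
    | zero => simp [hF]
    | succ n =>
      rw [coeff_succ_X_mul]
      simp only [coeff_C_mul, hF, coeff_rescale, coeff_mk]
      have := f_succ a p h0 h1 h n
      rw [← this]
      ring
  set H := E * F with hH
  have hh : C p * H = (C p + C a) * rescale p H - C a * (1 - C p * X) * rescale p (rescale p H) := by
    have : C p * H = rescale p E * ((1 - X) * (C p * F)) := by
      rw [hH]; conv_lhs => rw [e1]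
      ring
    rw [this, f1, hH, map_mul, map_mul]
    conv_lhs => rw [mul_sub]
    conv_lhs => rw [show rescale p E * (C a * rescale p (rescale p F)) = 
      C a * rescale p (rescale p F) * rescale p E by ring]
    nth_rewrite 2 [e2]
    ring
  ext n
  rw [coeff_mk]
  induction n with
  | zero => simp [hH, hE, hF, e, f, g, qPochR]
  | succ n ih =>
    have hc := congrArg (coeff (n + 1)) hh
    rw [mul_sub, mul_one, sub_mul, add_mul, map_sub, map_sub, map_add,
      show C a * (C p * X) * rescale p (rescale p H) = X * (C (a * p) * rescale p (rescale p H)) by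
        rw [map_mul C a p]; ring, coeff_succ_X_mul] at hc
    simp only [coeff_C_mul, coeff_rescale, ih] at hc
    have hg := g_succ a p h0 h1 h n
    have hk : (1 - p * p ^ n) * (1 - a * p ^ n) ≠ 0 := mul_ne_zero (pp_ne p h0 h1 n) (h n)
    apply mul_right_cancel₀ hk
    apply mul_left_cancel₀ h0.ne'
    rw [hg]
    rw [pow_succ] at hc
    rw [pow_mul']
    linear_combination hc

lemma tp (p c : ℝ) (h0 : 0 < p) (h1 : p < 1) : Tendsto (fun n : ℕ => 1 - c * p ^ n) atTop (𝓝 1) := by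
  have := ((tendsto_pow_atTop_nhds_zero_of_lt_one h0.le h1).const_mul c).const_sub 1
  simpa using this

lemma e_sum (p x : ℝ) (h0 : 0 < p) (h1 : p < 1) (hx : 0 < x) :
    Summable fun j => ‖e p j * x ^ j‖ := by
  have hne : ∀ j, e p j ≠ 0 := fun j => by
    unfold e
    have := poch_ne p p (pp_ne p h0 h1) j
    positivity
  refine (summable_of_ratio_test_tendsto_lt_one (l := 0) one_pos ?_ ?_).norm
  · exact Eventually.of_forall fun j => mul_ne_zero (hne j) (by positivity)
  · have : ∀ j, ‖e p (j + 1) * x ^ (j + 1)‖ / ‖e p j * x ^ j‖ = ‖p ^ j * x / (1 - p * p ^ j)‖ := by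
      intro j
      rw [← norm_div, ← norm_neg]
      congr 1
      have h3 := e_succ p h0 h1 j
      have h4 := pp_ne p h0 h1 j
      have h5 := hne j
      have h6 : x ^ j ≠ 0 := by positivity
      rw [pow_succ, ← neg_div, div_eq_div_iff (mul_ne_zero h5 h6) h4]
      linear_combination (-x ^ j * x) * h3
    simp_rw [this]
    have := (((tendsto_pow_atTop_nhds_zero_of_lt_one h0.le h1).mul_const x).div
      (tp p p h0 h1) one_ne_zero).norm
    simpa using this

lemma f_sum (a p x : ℝ) (h0 : 0 < p) (h1 : p < 1) (h : ∀ n : ℕ, 1 - a * p ^ n ≠ 0)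
    (hx : 0 < x) (hx1 : x < 1) :
    Summable fun j => ‖f a p j * x ^ j‖ := by
  have hne : ∀ j, f a p j ≠ 0 := fun j => by
    unfold f
    have := poch_ne p p (pp_ne p h0 h1) j
    have := poch_ne a p h j
    positivity
  refine (summable_of_ratio_test_tendsto_lt_one (l := x) hx1 ?_ ?_).norm
  · exact Eventually.of_forall fun j => mul_ne_zero (hne j) (by positivity)
  · have : ∀ j, ‖f a p (j + 1) * x ^ (j + 1)‖ / ‖f a p j * x ^ j‖
        = ‖x / ((1 - p * p ^ j) * (1 - a * p ^ j))‖ := by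
      intro j
      rw [← norm_div]
      congr 1
      have h3 := f_succ a p h0 h1 h j
      have h4 := pp_ne p h0 h1 j
      have h6 := h j
      have h5 := hne j
      have h7 : x ^ j ≠ 0 := by positivity
      rw [pow_succ, div_eq_div_iff (mul_ne_zero h5 h7) (mul_ne_zero h4 h6)]
      linear_combination (x ^ j * x) * h3
    simp_rw [this]
    have := ((tendsto_const_nhds (x := x)).div
      ((tp p p h0 h1).mul (tp p a h0 h1)) (by norm_num)).norm
    simpa [abs_of_pos hx] using this

lemma euler (p x : ℝ) (h0 : 0 < p) (h1 : p < 1) (hx : 0 < x) :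
    ∑' j, e p j * x ^ j = qPochInfR x p := by
  have step : ∀ y : ℝ, 0 < y → ∑' j, e p j * y ^ j = (1 - y) * ∑' j, e p j * (p * y) ^ j := by
    intro y hy
    have s1 := (e_sum p y h0 h1 hy).of_norm
    have s2 := (e_sum p (p * y) h0 h1 (by positivity)).of_norm
    rw [sub_mul, one_mul]
    have k1 : ∑' j, e p j * y ^ j - ∑' j, e p j * (p * y) ^ j
        = - (y * ∑' j, e p j * (p * y) ^ j) := by
      rw [← s1.tsum_sub s2, (s1.sub s2).tsum_eq_zero_add, ← tsum_mul_left, ← tsum_neg]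
      simp only [pow_zero, sub_self, zero_add]
      congr 1
      funext j
      have := e_succ p h0 h1 j
      rw [mul_pow, mul_pow, pow_succ, pow_succ]
      linear_combination (y ^ j * y) * this
    linarith
  have it : ∀ n : ℕ, ∑' j, e p j * x ^ j = qPochR x p n * ∑' j, e p j * (p ^ n * x) ^ j := by
    intro n
    induction n with
    | zero => simp [qPochR]
    | succ n ih =>
      rw [ih, step _ (by positivity), poch_succ, pow_succ']
      ring_nf
  have l1 : Tendsto (fun n => qPochR x p n) atTop (𝓝 (qPochInfR x p)) :=
    (mult x p h0 h1).hasProd.tendsto_prod_nat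
  have l2 : Tendsto (fun n : ℕ => ∑' j, e p j * (p ^ n * x) ^ j) atTop (𝓝 (∑' j, e p j * 0 ^ j)) := by
    apply tendsto_tsum_of_dominated_convergence (e_sum p x h0 h1 hx)
    · intro j
      have := (tendsto_pow_atTop_nhds_zero_of_lt_one h0.le h1).mul_const x
      rw [zero_mul] at this
      exact (this.pow j).const_mul _
    · refine Eventually.of_forall fun n j => ?_
      rw [norm_mul, norm_mul, norm_pow, norm_pow]
      gcongr
      rw [norm_mul, norm_pow, Real.norm_of_nonneg h0.le]
      exact mul_le_of_le_one_left (norm_nonneg _) (pow_le_one₀ h0.le h1.le)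
  have l3 : ∑' j, e p j * (0:ℝ) ^ j = 1 := by
    rw [tsum_eq_single 0]
    · simp [e, qPochR]
    · intro j hj; simp [hj]
  rw [l3] at l2
  have l4 := l1.mul l2
  rw [mul_one] at l4
  refine tendsto_nhds_unique ?_ l4
  simp_rw [← it]
  exact tendsto_const_nhds

lemma core (a p x : ℝ) (h0 : 0 < p) (h1 : p < 1) (h : ∀ n : ℕ, 1 - a * p ^ n ≠ 0)
    (hx : 0 < x) (hx1 : x < 1) :
    ∑' j, g a p j * x ^ j = qPochInfR x p * ∑' j, f a p j * x ^ j := by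
  rw [← euler p x h0 h1 hx, tsum_mul_tsum_eq_tsum_sum_antidiagonal_of_summable_norm
    (e_sum p x h0 h1 hx) (f_sum a p x h0 h1 h hx hx1)]
  congr 1
  funext n
  have := congrArg (PowerSeries.coeff n) (conv a p h0 h1 h)
  rw [PowerSeries.coeff_mul] at this
  simp only [PowerSeries.coeff_mk] at this
  rw [← this, Finset.sum_mul]
  refine Finset.sum_congr rfl fun ij hij => ?_
  rw [← Finset.HasAntidiagonal.mem_antidiagonal.mp hij, pow_add]
  ring

end QB

open QB in
theorem stmt13 (q : ℝ) (hq0 : 0 < q) (hq1 : q < 1) (ν : ℝ)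
    (hν : ∀ m : ℤ, m < 0 → ν ≠ m)
    (z : ℝ) (hz0 : 0 < z) (hz : z < 2 / (1 - q ^ 2)) :
    I2 q ν z = qExpE2R q (-((1 - q ^ 2) ^ 2 * z ^ 2 / 4)) * I1 q ν z := by
  have hp0 : 0 < q ^ 2 := by positivity
  have hp1 : q ^ 2 < 1 := by nlinarith
  have h1p : 0 < 1 - q ^ 2 := by linarith
  set a := Real.exp (2 * (ν + 1) * Real.log q) with ha
  set x := (1 - q ^ 2) ^ 2 * z ^ 2 / 4 with hx
  have hlog : Real.log q < 0 := Real.log_neg hq0 hq1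
  have hx0 : 0 < x := by positivity
  have hx1 : x < 1 := by
    rw [lt_div_iff₀ h1p] at hz
    have : 0 < z * (1 - q ^ 2) := by positivity
    rw [hx]; nlinarith
  have hak : ∀ k : ℕ, Real.exp (2 * (ν + k + 1) * Real.log q) = a * (q ^ 2) ^ k := by
    intro k
    rw [ha, ← pow_mul, ← Real.rpow_natCast, Real.rpow_def_of_pos hq0, ← Real.exp_add]
    congr 1; push_cast; ring
  have hne : ∀ n : ℕ, 1 - a * (q ^ 2) ^ n ≠ 0 := by
    intro n hn
    rw [← hak] at hn
    have h2 : Real.exp (2 * (ν + n + 1) * Real.log q) = 1 := by linarith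
    rw [Real.exp_eq_one_iff] at h2
    have h3 : ν + n + 1 = 0 := by
      rcases mul_eq_zero.mp h2 with h | h
      · linarith
      · exact absurd h hlog.ne
    apply hν (-(n + 1 : ℤ)) (by omega)
    push_cast; linarith
  set K := ((1 - q ^ 2) * (z / 2)) ^ ν * qPochInfR a (q ^ 2) / qPochInfR (q ^ 2) (q ^ 2) with hK
  have term : ∀ k : ℕ, (1 - q ^ 2) ^ k * (z / 2) ^ (ν + 2 * (k : ℝ)) /
    (qPochR (q ^ 2) (q ^ 2) k * qGamma2 q (ν + k + 1)) = K * (f a (q ^ 2) k * x ^ k) := by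
    intro k
    have hpk := poch_ne a (q ^ 2) hne k
    have e1 : (z / 2) ^ (ν + 2 * (k : ℝ)) = (z / 2) ^ ν * (z / 2) ^ (2 * k) := by
      rw [Real.rpow_add (by positivity), ← Real.rpow_natCast]; push_cast; rfl
    have e2 : (1 - q ^ 2) ^ (1 - (ν + k + 1)) = ((1 - q ^ 2) ^ ν * (1 - q ^ 2) ^ k)⁻¹ := by
      rw [← Real.rpow_natCast (1 - q ^ 2) k, ← Real.rpow_add h1p, ← Real.rpow_neg h1p.le]
      congr 1; ring
    have e3 : x ^ k = (1 - q ^ 2) ^ k * (1 - q ^ 2) ^ k * (z / 2) ^ (2 * k) := by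
      have h5 : x = (1 - q ^ 2) * (1 - q ^ 2) * (z / 2) ^ 2 := by rw [hx]; ring
      rw [h5, mul_pow, mul_pow, pow_mul]
    unfold qGamma2
    rw [hak, e1, e2, e3, hK, inf_split a _ hp0 hp1 k, Real.mul_rpow h1p.le (by positivity)]
    unfold f
    generalize qPochInfR (a * (q ^ 2) ^ k) (q ^ 2) = c
    simp only [div_eq_mul_inv, mul_inv, inv_inv]
    field_simp
  have term2 : ∀ k : ℕ, q ^ (2 * (k : ℝ) * (ν + k)) * (1 - q ^ 2) ^ k * (z / 2) ^ (ν + 2 * (k : ℝ)) /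
    (qPochR (q ^ 2) (q ^ 2) k * qGamma2 q (ν + k + 1)) = K * (g a (q ^ 2) k * x ^ k) := by
    intro k
    have e1 : q ^ (2 * (k : ℝ) * (ν + k)) = (q ^ 2) ^ (k * (k - 1)) * a ^ k := by
      rw [ha, ← pow_mul, ← Real.rpow_natCast, Real.rpow_def_of_pos hq0, Real.rpow_def_of_pos hq0,
        ← Real.exp_nat_mul, ← Real.exp_add]
      congr 1
      cases k <;> simp
      ring
    rw [mul_assoc, mul_div_assoc, term, e1]
    unfold f g
    ring
  unfold I1 I2 qExpE2R
  simp_rw [term, term2, tsum_mul_left]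
  rw [core a _ x hp0 hp1 hne hx0 hx1, neg_neg]
  ring
end
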